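/- The number of isomorphism classes of trees on 21 vertices is 2144505; that is, the quotient of the set of simple graphs on a fixed 21-element vertex set that are connected and acyclic, by the relation of graph isomorphism, has cardinality 2144505. -/

import Mathlib

/-- The setoid on trees (connected acyclic simple graphs) on the vertex set `Fin n`
given by graph isomorphism. -/
def treeIsoSetoid (n : ℕ) :
    Setoid {G : SimpleGraph (Fin n) // G.Connected ∧ G.IsAcyclic} where
  r T S := Nonempty (T.1 ≃g S.1)
  iseqv :=
    ⟨fun _ => ⟨SimpleGraph.Iso.refl⟩,
     fun ⟨e⟩ => ⟨e.symm⟩,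
     fun ⟨e⟩ ⟨e'⟩ => ⟨e.trans e'⟩⟩

namespace SimpleGraph

variable {V W : Type*} {G : SimpleGraph V} {H : SimpleGraph W} {r w x y : V}

/-- The vertices reachable from `w` by a walk avoiding `r`. -/
def branch (G : SimpleGraph V) (r w : V) : Set V := {x | ∃ p : G.Walk w x, r ∉ p.support}

lemma ne_of_mem_branch (h : x ∈ G.branch r w) : x ≠ r := by
  obtain ⟨p, hp⟩ := h
  rintro rfl
  exact hp p.end_mem_support

lemma mem_branch_self (h : w ≠ r) : w ∈ G.branch r w :=
  ⟨.nil, by simpa using h.symm⟩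

lemma mem_branch_trans (h : x ∈ G.branch r w) (h' : y ∈ G.branch r x) : y ∈ G.branch r w := by
  obtain ⟨p, hp⟩ := h
  obtain ⟨q, hq⟩ := h'
  exact ⟨p.append q, by simp [Walk.mem_support_append_iff, hp, hq]⟩

lemma mem_branch_of_adj (h : x ∈ G.branch r w) (hxy : G.Adj x y) (hy : y ≠ r) :
    y ∈ G.branch r w :=
  mem_branch_trans h ⟨.cons hxy .nil, by simp [(ne_of_mem_branch h).symm, hy.symm]⟩

lemma Connected.exists_mem_branch (hG : G.Connected) (hx : x ≠ r) :
    ∃ w, G.Adj r w ∧ x ∈ G.branch r w := by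
  obtain ⟨p, hp⟩ := hG.exists_isPath r x
  cases p with
  | nil => exact absurd rfl hx
  | cons h q => exact ⟨_, h, q, ((Walk.cons_isPath_iff h q).1 hp).2⟩

lemma IsAcyclic.eq_of_mem_branch (hG : G.IsAcyclic) {w' : V} (hw : G.Adj r w)
    (hw' : G.Adj r w') (h : x ∈ G.branch r w) (h' : x ∈ G.branch r w') : w = w' := by
  classical
  obtain ⟨p, hp⟩ := h
  obtain ⟨q, hq⟩ := h'
  let s := (p.append q.reverse).bypass
  have hs : r ∉ s.support := fun hr => by
    have := Walk.support_bypass_subset_support _ hr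
    simp [Walk.mem_support_append_iff, hp, hq] at this
  have hpath : (Walk.cons hw s).IsPath :=
    (Walk.cons_isPath_iff hw s).2 ⟨Walk.bypass_isPath _, hs⟩
  have hpath' : (Walk.cons hw' .nil).IsPath := by simp [hw'.ne]
  have hEq := congrArg (fun p : G.Path r w' => p.1.snd)
    ((hG.subsingleton_path _ _).elim ⟨_, hpath⟩ ⟨_, hpath'⟩)
  simpa using hEq

lemma IsAcyclic.disjoint_branch (hG : G.IsAcyclic) (h : G.Adj r w) :
    Disjoint (G.branch r w) (G.branch w r) := by
  classical
  refine Set.disjoint_left.2 ?_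
  rintro x ⟨p, hp⟩ ⟨q, hq⟩
  have hpath : (Walk.cons h p.bypass).IsPath :=
    (Walk.cons_isPath_iff h _).2
      ⟨Walk.bypass_isPath _, fun hr => hp (Walk.support_bypass_subset_support _ hr)⟩
  have hEq := congrArg (fun p : G.Path r x => p.1.support)
    ((hG.subsingleton_path _ _).elim ⟨_, hpath⟩ ⟨_, q.bypass_isPath⟩)
  refine hq (Walk.support_bypass_subset_support _ ?_)
  simp only at hEq
  simp [← hEq]

lemma IsTree.induce_branch (hG : G.IsTree) (hw : w ≠ r) : (G.induce (G.branch r w)).IsTree := by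
  classical
  refine ⟨?_, hG.isAcyclic.induce _⟩
  refine (connected_iff_exists_forall_reachable _).2 ⟨⟨w, mem_branch_self hw⟩, ?_⟩
  rintro ⟨x, p, hp⟩
  exact ⟨p.induce (G.branch r w) fun y hy =>
    ⟨p.takeUntil y hy, fun hr => hp (p.support_takeUntil_subset_support hy hr)⟩⟩

lemma Iso.bijOn_branch (φ : G ≃g H) (r w : V) :
    Set.BijOn φ (G.branch r w) (H.branch (φ r) (φ w)) := by
  refine ⟨?_, φ.injective.injOn, ?_⟩
  · rintro x ⟨p, hp⟩
    exact ⟨p.map φ.toHom, by simpa using hp⟩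
  · rintro y ⟨p, hp⟩
    refine ⟨φ.symm y, ⟨(p.map φ.symm.toHom).copy (by simp) rfl, ?_⟩, by simp⟩
    intro h
    simp only [Walk.support_copy, Walk.support_map, List.mem_map] at h
    obtain ⟨a, ha, h⟩ := h
    refine hp ?_
    rw [← h]
    simpa using ha

/-- A centroid: some vertex has no branch containing more than half of the vertices. -/
lemma IsTree.exists_forall_two_mul_ncard_branch_le [Finite V] (hG : G.IsTree) :
    ∃ r, ∀ w, G.Adj r w → 2 * (G.branch r w).ncard ≤ Nat.card V := by
  by_contra! hbig
  have key : ∀ k r w, G.Adj r w → Nat.card V < 2 * (G.branch r w).ncard →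
      (G.branch r w).ncard ≤ k → False := by
    intro k
    induction k with
    | zero => intro r w _ h h'; omega
    | succ k ih =>
      intro r w hrw hlt hle
      obtain ⟨w', hw', hlt'⟩ := hbig w
      by_cases hr : w' = r
      · subst hr
        have h₁ := Set.ncard_union_eq (hG.isAcyclic.disjoint_branch hrw)
        have h₂ := Set.ncard_le_card (G.branch w' w ∪ G.branch w w')
        omega
      · refine ih w w' hw' hlt' (Nat.le_of_lt_succ (lt_of_lt_of_le ?_ hle))
        refine Set.ncard_lt_ncard ⟨?_, fun h => ?_⟩
        · classical
          rintro x ⟨p, hp⟩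
          refine ⟨.cons hw' p, ?_⟩
          simp only [Walk.support_cons, List.mem_cons, not_or]
          refine ⟨hrw.ne, fun hrp => hr ?_⟩
          exact hG.isAcyclic.eq_of_mem_branch hw' hrw.symm
            ⟨p.takeUntil r hrp, fun h => hp (p.support_takeUntil_subset_support hrp h)⟩
            (mem_branch_self hrw.ne)
        · exact ne_of_mem_branch (h (mem_branch_self hrw.ne.symm)) rfl
  obtain ⟨r⟩ := hG.connected.nonempty
  obtain ⟨w, hw, hlt⟩ := hbig r
  exact key _ r w hw hlt le_rfl

lemma Connected.eq_of_forall_two_mul_ncard_branch_lt [Finite V] (hG : G.Connected) {r' : V}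
    (h : ∀ w, G.Adj r w → 2 * (G.branch r w).ncard < Nat.card V)
    (h' : ∀ w, G.Adj r' w → 2 * (G.branch r' w).ncard < Nat.card V) : r = r' := by
  classical
  by_contra hne
  obtain ⟨w, hw, hr'⟩ := hG.exists_mem_branch (Ne.symm hne)
  obtain ⟨w', hw', hr⟩ := hG.exists_mem_branch hne
  have hcover : G.branch r w ∪ G.branch r' w' = Set.univ := by
    refine Set.eq_univ_of_forall fun x => ?_
    obtain ⟨p, hp⟩ := hG.exists_isPath r x
    by_cases hmem : r' ∈ p.support
    · left
      cases p with
      | nil => simp [Ne.symm hne] at hmem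
      | cons ha q =>
        have hq := ((Walk.cons_isPath_iff ha q).1 hp).2
        have hmem' : r' ∈ q.support := by simpa [Ne.symm hne] using hmem
        exact mem_branch_trans hr'
          ⟨q.dropUntil r' hmem', fun hh => hq (q.support_dropUntil_subset_support hmem' hh)⟩
    · exact .inr (mem_branch_trans hr ⟨p, hmem⟩)
  have h₁ := Set.ncard_union_le (G.branch r w) (G.branch r' w')
  rw [hcover, Set.ncard_univ] at h₁
  have := h w hw
  have := h' w' hw'
  omega

end SimpleGraph

namespace Multiset

/-- The multiset of values of a finite family. -/
noncomputable def ofFamily {ι α : Type*} [Finite ι] (f : ι → α) : Multiset α :=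
  letI := Fintype.ofFinite ι
  Finset.univ.val.map f

section ofFamily

variable {ι κ α : Type*} [Finite ι] [Finite κ]

lemma mem_ofFamily {f : ι → α} {a : α} : a ∈ ofFamily f ↔ ∃ i, f i = a := by
  simp [ofFamily]

lemma ofFamily_eq_iff {f : ι → α} {g : κ → α} :
    ofFamily f = ofFamily g ↔ ∃ e : ι ≃ κ, ∀ i, f i = g (e i) := by
  classical
  let _ := Fintype.ofFinite ι
  let _ := Fintype.ofFinite κ
  constructor
  · intro h
    have hcard (a : α) : Nonempty ({i // f i = a} ≃ {k // g k = a}) := by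
      have := congrArg (count a) h
      simp only [ofFamily, count_map] at this
      refine ⟨Fintype.equivOfCardEq ?_⟩
      rw [Fintype.card_subtype, Fintype.card_subtype]
      simpa [Finset.card, eq_comm] using this
    exact ⟨Equiv.ofFiberEquiv fun a => (hcard a).some,
      fun i => (Equiv.ofFiberEquiv_map _ i).symm⟩
  · rintro ⟨e, he⟩
    obtain rfl : f = g ∘ e := funext he
    simp only [ofFamily]
    rw [← map_map, map_univ_val_equiv]

lemma exists_eq_ofFamily (m : Multiset α) : ∃ (n : ℕ) (f : Fin n → α), m = ofFamily f := by
  induction m using Quotient.inductionOn with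
  | h l =>
    refine ⟨l.length, l.get, ?_⟩
    have : Fintype.ofFinite (Fin l.length) = Fin.fintype _ := Subsingleton.elim _ _
    rw [ofFamily, this]
    exact congrArg _ (List.map_get_finRange l).symm

lemma sum_ofFamily [AddCommMonoid α] [Fintype ι] (f : ι → α) :
    (ofFamily f).sum = ∑ i, f i := by
  have : Fintype.ofFinite ι = ‹_› := Subsingleton.elim _ _
  rw [ofFamily, this]
  rfl

lemma map_ofFamily {β : Type*} (f : ι → α) (g : α → β) :
    (ofFamily f).map g = ofFamily (g ∘ f) := by
  simp [ofFamily]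

end ofFamily

section weight

variable {α : Type*} (s : α → ℕ)

/-- Multisets of total weight `n` all of whose elements have weight at most `k`. -/
abbrev BoundedWeight (k n : ℕ) : Type _ :=
  {m : Multiset α // (∀ a ∈ m, s a ≤ k) ∧ (m.map s).sum = n}

/-- Counts multisets of total weight `n`, where the given list holds the numbers of elements
of weight `k, k - 1, …, 1`. -/
def weightCount : List ℕ → ℕ → ℕ
  | [], n => if n = 0 then 1 else 0
  | a :: l, n => ∑ j ∈ Finset.range (n / (l.length + 1) + 1),
      (a + j - 1).descFactorial j / j.factorial * weightCount l (n - (l.length + 1) * j)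

/-- Splits off the elements of maximal weight. -/
noncomputable def boundedWeightSuccEquiv (k n : ℕ) :
    (Σ j : Fin (n / (k + 1) + 1), Sym {a // s a = k + 1} j × BoundedWeight s k (n - (k + 1) * j)) ≃
      BoundedWeight s (k + 1) n := by
  refine Equiv.ofBijective (fun p => ⟨p.2.1.1.map Subtype.val + p.2.2.1, ?_, ?_⟩) ⟨?_, ?_⟩
  · intro a ha
    rcases mem_add.1 ha with ha | ha
    · obtain ⟨b, -, rfl⟩ := mem_map.1 ha
      exact b.2.le
    · exact (p.2.2.2.1 a ha).trans k.le_succ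
  · obtain ⟨j, ⟨t, ht⟩, m, hm, hsum⟩ := p
    have hconst : (t.map fun a => s a.1) = replicate (j : ℕ) (k + 1) := by
      rw [← ht, ← map_const']
      exact map_congr rfl fun a _ => a.2
    have hj : (k + 1) * (j : ℕ) ≤ n :=
      (Nat.mul_le_mul_left _ (Nat.le_of_lt_succ j.2)).trans (Nat.mul_div_le _ _)
    simp only [map_add, map_map, Function.comp_def, sum_add, hsum]
    rw [hconst, sum_replicate, smul_eq_mul, mul_comm]
    omega
  · rintro ⟨j, ⟨t, ht⟩, m, hm, hsum⟩ ⟨j', ⟨t', ht'⟩, m', hm', hsum'⟩ h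
    have h : t.map (↑) + m = t'.map (↑) + m' := congrArg Subtype.val h
    have hfilter : ∀ (t : Multiset {a // s a = k + 1}) (m : Multiset α), (∀ a ∈ m, s a ≤ k) →
        filter (fun a => s a = k + 1) (t.map (↑) + m) = t.map (↑) := by
      intro t m hm
      rw [filter_add, filter_eq_self.2, filter_eq_nil.2, add_zero]
      · intro a ha h
        have := hm a ha
        omega
      · intro a ha
        obtain ⟨b, -, rfl⟩ := mem_map.1 ha
        exact b.2
    have htt : t.map (↑) = t'.map ((↑) : {a // s a = k + 1} → α) := by
      rw [← hfilter t m hm, h, hfilter t' m' hm']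
    rw [htt] at h
    obtain rfl := add_left_cancel h
    obtain rfl := map_injective Subtype.val_injective htt
    obtain rfl : j = j' := Fin.ext (ht.symm.trans ht')
    rfl
  · rintro ⟨m, hm, hsum⟩
    let t : Multiset {a // s a = k + 1} :=
      (filter (fun a => s a = k + 1) m).attach.map
        fun a => ⟨a.1, (mem_filter (p := fun a => s a = k + 1).1 a.2).2⟩
    have ht : t.map (↑) = filter (fun a => s a = k + 1) m := by
      simp [t, map_map]
    have hsplit := filter_add_not (fun a => s a = k + 1) m
    have htsum : ((filter (fun a => s a = k + 1) m).map s).sum = (k + 1) * card t := by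
      rw [← ht, map_map, map_congr rfl (fun a _ => show (s ∘ (↑)) a = k + 1 from a.2),
        map_const', sum_replicate, smul_eq_mul, mul_comm]
    have hsum' := congrArg (fun m => (m.map s).sum) hsplit
    simp only [map_add, sum_add, hsum, htsum] at hsum'
    have hcard : card t < n / (k + 1) + 1 :=
      Nat.lt_succ_of_le ((Nat.le_div_iff_mul_le (Nat.add_one_pos k)).2 (by rw [mul_comm]; omega))
    refine ⟨⟨⟨card t, hcard⟩, ⟨t, rfl⟩, filter (fun a => ¬ s a = k + 1) m, ?_, ?_⟩, ?_⟩
    · intro a ha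
      have h₁ := hm a (mem_filter.1 ha).1
      have h₂ := (mem_filter.1 ha).2
      omega
    · simp only
      omega
    · exact Subtype.ext (by simpa [ht] using hsplit)

/-- The numbers of elements of weight `k, k - 1, …, 1`. -/
noncomputable def fiberCards : ℕ → List ℕ
  | 0 => []
  | k + 1 => Nat.card {a // s a = k + 1} :: fiberCards k

lemma length_fiberCards (k : ℕ) : (fiberCards s k).length = k := by
  induction k with
  | zero => rfl
  | succ k ih => simp [fiberCards, ih]

variable {s}

lemma finite_and_card_boundedWeight (hs : ∀ a, 0 < s a) (k n : ℕ)
    (hfin : ∀ j ≤ k, Finite {a // s a = j}) :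
    Finite (BoundedWeight s k n) ∧
      Nat.card (BoundedWeight s k n) = weightCount (fiberCards s k) n := by
  induction k generalizing n with
  | zero =>
    have hzero (m : BoundedWeight s 0 n) : m.1 = 0 :=
      eq_zero_of_forall_notMem fun a ha => (hs a).ne' (Nat.le_zero.1 (m.2.1 a ha))
    have hsub : Subsingleton (BoundedWeight s 0 n) :=
      ⟨fun a b => Subtype.ext ((hzero a).trans (hzero b).symm)⟩
    refine ⟨inferInstance, ?_⟩
    by_cases hn : n = 0
    · subst hn
      have : Nonempty (BoundedWeight s 0 0) := ⟨⟨0, by simp, by simp⟩⟩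
      simp [fiberCards, weightCount]
    · have : IsEmpty (BoundedWeight s 0 n) := ⟨fun m => hn <| by
        rw [← m.2.2, hzero m]
        simp⟩
      simp [fiberCards, weightCount, hn]
  | succ k ih =>
    have ih' := fun n => ih n fun j hj => hfin j (hj.trans k.le_succ)
    have := fun n => (ih' n).1
    have := hfin (k + 1) le_rfl
    have hsym (j : ℕ) : Finite (Sym {a // s a = k + 1} j) := by
      classical
      let _ := Fintype.ofFinite {a // s a = k + 1}
      exact Finite.of_fintype _
    refine ⟨.of_equiv _ (boundedWeightSuccEquiv s k n), ?_⟩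
    rw [← Nat.card_congr (boundedWeightSuccEquiv s k n), Nat.card_sigma]
    simp only [Nat.card_prod, (ih' _).2, fiberCards, weightCount, length_fiberCards]
    rw [Fin.sum_univ_eq_sum_range (fun j => Nat.card (Sym {a // s a = k + 1} j) *
      weightCount (fiberCards s k) (n - (k + 1) * j))]
    refine Finset.sum_congr rfl fun j _ => ?_
    rw [Sym.natCard_sym_eq_choose, Nat.choose_eq_descFactorial_div_factorial]

end weight

end Multiset

namespace SimpleGraph

section glue

variable {ι : Type*} {V : ι → Type*} {G : ∀ i, SimpleGraph (V i)} {r : ∀ i, V i}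

/-- Adjacency in the graph obtained from rooted graphs by joining all roots to a new vertex. -/
inductive GlueAdj (G : ∀ i, SimpleGraph (V i)) (r : ∀ i, V i) :
    Option (Σ i, V i) → Option (Σ i, V i) → Prop
  | root (i : ι) : GlueAdj G r none (some ⟨i, r i⟩)
  | root_symm (i : ι) : GlueAdj G r (some ⟨i, r i⟩) none
  | inner {i : ι} {x y : V i} (h : (G i).Adj x y) : GlueAdj G r (some ⟨i, x⟩) (some ⟨i, y⟩)

/-- The graph obtained from a family of rooted graphs by joining all roots to a new vertex. -/
def glue (G : ∀ i, SimpleGraph (V i)) (r : ∀ i, V i) : SimpleGraph (Option (Σ i, V i)) where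
  Adj := GlueAdj G r
  symm := ⟨fun _ _ h => by
    cases h with
    | root i => exact .root_symm i
    | root_symm i => exact .root i
    | inner h => exact .inner h.symm⟩
  loopless := ⟨fun _ h => by
    cases h with
    | inner h => exact h.ne rfl⟩

lemma glue_adj_none {i : ι} {x : V i} : (glue G r).Adj none (some ⟨i, x⟩) ↔ x = r i :=
  ⟨fun h => by cases h; rfl, fun h => h ▸ .root i⟩

lemma glue_adj_some {i : ι} {x y : V i} :
    (glue G r).Adj (some ⟨i, x⟩) (some ⟨i, y⟩) ↔ (G i).Adj x y :=
  ⟨fun h => by cases h; assumption, .inner⟩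

/-- The inclusion of one of the glued graphs. -/
def glueEmbedding (G : ∀ i, SimpleGraph (V i)) (r : ∀ i, V i) (i : ι) : G i ↪g glue G r where
  toFun x := some ⟨i, x⟩
  inj' x y h := by simpa using h
  map_rel_iff' := glue_adj_some

lemma branch_glue (hG : ∀ i, (G i).Connected) (i : ι) :
    (glue G r).branch none (some ⟨i, r i⟩) = Set.range (glueEmbedding G r i) := by
  apply Set.Subset.antisymm
  · have key : ∀ {a b} (p : (glue G r).Walk a b), none ∉ p.support →
        a ∈ Set.range (glueEmbedding G r i) → b ∈ Set.range (glueEmbedding G r i) := by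
      intro a b p
      induction p with
      | nil => exact fun _ h => h
      | cons h p ih =>
        intro hp ha
        simp only [Walk.support_cons, List.mem_cons, not_or] at hp
        refine ih hp.2 ?_
        obtain ⟨x, rfl⟩ := ha
        cases h with
        | root_symm => exact absurd p.start_mem_support hp.2
        | inner h => exact ⟨_, rfl⟩
    rintro x ⟨p, hp⟩
    exact key p hp ⟨r i, rfl⟩
  · rintro _ ⟨x, rfl⟩
    obtain ⟨p⟩ := (hG i).preconnected (r i) x
    exact ⟨p.map (glueEmbedding G r i).toHom, by simp [glueEmbedding]⟩

lemma glue_connected (hG : ∀ i, (G i).Connected) : (glue G r).Connected := by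
  refine (connected_iff_exists_forall_reachable _).2 ⟨none, ?_⟩
  rintro (_ | ⟨i, x⟩)
  · rfl
  · have h : (glue G r).Adj none (some ⟨i, r i⟩) := glue_adj_none.2 rfl
    exact h.reachable.trans (((hG i).preconnected (r i) x).map (glueEmbedding G r i).toHom)

lemma glue_isTree [Finite ι] [∀ i, Finite (V i)] (hG : ∀ i, (G i).IsTree) :
    (glue G r).IsTree := by
  have hsurj : Function.Surjective (Sum.elim
      (fun i => ⟨s(none, some ⟨i, r i⟩), glue_adj_none.2 rfl⟩)
      (fun p : Σ i, (G i).edgeSet => (glueEmbedding G r p.1).mapEdgeSet p.2) :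
        ι ⊕ (Σ i, (G i).edgeSet) → (glue G r).edgeSet) := by
    rintro ⟨e, he⟩
    induction e using Sym2.ind with
    | _ a b =>
      cases he with
      | root i => exact ⟨.inl i, rfl⟩
      | root_symm i => exact ⟨.inl i, Subtype.ext Sym2.eq_swap⟩
      | @inner i x y h => exact ⟨.inr ⟨i, s(x, y), h⟩, rfl⟩
  have hconn := glue_connected (r := r) fun i => (hG i).connected
  refine isTree_iff_connected_and_card.2 ⟨hconn,
    le_antisymm ?_ hconn.card_vert_le_card_edgeSet_add_one⟩
  have := Fintype.ofFinite ι
  have hle := Nat.card_le_card_of_surjective _ hsurj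
  rw [Nat.card_sum, Nat.card_sigma] at hle
  have hV : Nat.card (Σ i, V i) = ∑ i, (Nat.card (G i).edgeSet + 1) := by
    rw [Nat.card_sigma]
    exact Finset.sum_congr rfl fun i _ => (isTree_iff_connected_and_card.1 (hG i)).2.symm
  rw [Finite.card_option, hV, Finset.sum_add_distrib]
  simp only [Finset.sum_const, Finset.card_univ, smul_eq_mul, mul_one,
    ← Nat.card_eq_fintype_card]
  omega

end glue

end SimpleGraph

/-- A finite tree with a distinguished vertex. -/
structure RootedSimpleTree where
  V : Type
  [finite : Finite V]
  graph : SimpleGraph V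
  root : V
  isTree : graph.IsTree

namespace RootedSimpleTree

open SimpleGraph Multiset

attribute [instance] RootedSimpleTree.finite

instance : Setoid RootedSimpleTree where
  r T S := ∃ φ : T.graph ≃g S.graph, φ T.root = S.root
  iseqv :=
    ⟨fun _ => ⟨.refl, rfl⟩,
      fun ⟨φ, h⟩ => ⟨φ.symm, by rw [← h]; exact φ.symm_apply_apply _⟩,
      fun ⟨φ, h⟩ ⟨ψ, h'⟩ => ⟨φ.trans ψ, by rw [← h', ← h]; rfl⟩⟩

/-- The branch hanging from the root at one of its neighbors. -/
def child (T : RootedSimpleTree) (w : T.graph.neighborSet T.root) : RootedSimpleTree where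
  V := T.graph.branch T.root w
  graph := T.graph.induce _
  root := ⟨w, mem_branch_self w.2.ne'⟩
  isTree := T.isTree.induce_branch w.2.ne'

/-- The rooted tree whose root carries the given branches. -/
def join {ι : Type} [Finite ι] (T : ι → RootedSimpleTree) : RootedSimpleTree where
  V := Option (Σ i, (T i).V)
  graph := glue (fun i => (T i).graph) fun i => (T i).root
  root := none
  isTree := glue_isTree fun i => (T i).isTree

section join

variable {ι : Type} [Finite ι] {T : ι → RootedSimpleTree} {i : ι} {x y : (T i).V}

lemma join_adj_root : (join T).graph.Adj (join T).root (some ⟨i, x⟩) ↔ x = (T i).root :=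
  glue_adj_none

lemma join_adj_root_symm : (join T).graph.Adj (some ⟨i, x⟩) (join T).root ↔ x = (T i).root :=
  (SimpleGraph.adj_comm _ _ _).trans join_adj_root

lemma join_adj_some : (join T).graph.Adj (some ⟨i, x⟩) (some ⟨i, y⟩) ↔ (T i).graph.Adj x y :=
  glue_adj_some

lemma eq_of_join_adj {j : ι} {z : (T j).V} (h : (join T).graph.Adj (some ⟨i, x⟩) (some ⟨j, z⟩)) :
    i = j := by
  cases h
  rfl

end join

lemma join_congr {ι κ : Type} [Finite ι] [Finite κ] {T : ι → RootedSimpleTree} {S : κ → RootedSimpleTree}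
    (e : ι ≃ κ) (h : ∀ i, T i ≈ S (e i)) : join T ≈ join S := by
  choose φ hφ using h
  have hroot (i : ι) (x : (T i).V) : φ i x = (S (e i)).root ↔ x = (T i).root := by
    rw [← hφ, (φ i).injective.eq_iff]
  refine ⟨⟨(Equiv.sigmaCongr e fun i => (φ i).toEquiv).optionCongr, ?_⟩, rfl⟩
  rintro (_ | ⟨i, x⟩) (_ | ⟨j, y⟩)
  · exact iff_of_false (SimpleGraph.irrefl _) (SimpleGraph.irrefl _)
  · exact (join_adj_root (T := S) (x := φ j y)).trans ((hroot j y).trans join_adj_root.symm)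
  · exact (join_adj_root_symm (T := S) (x := φ i x)).trans
      ((hroot i x).trans join_adj_root_symm.symm)
  · by_cases hij : i = j
    · subst hij
      exact (join_adj_some (T := S) (x := φ i x) (y := φ i y)).trans
        ((φ i).map_adj_iff.trans join_adj_some.symm)
    · exact iff_of_false
        (fun h => hij (e.injective (eq_of_join_adj (T := S) (x := φ i x) (z := φ j y) h)))
        fun h => hij (eq_of_join_adj h)

lemma join_child (T : RootedSimpleTree) : join T.child ≈ T := by
  let f : (join T.child).V → T.V := fun x => x.elim T.root fun p => p.2.1
  have hbij : Function.Bijective f := by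
    constructor
    · rintro (_ | ⟨w, x⟩) (_ | ⟨w', x'⟩) h
      · rfl
      · exact absurd h.symm (ne_of_mem_branch x'.2)
      · exact absurd h (ne_of_mem_branch x.2)
      · obtain ⟨x, hx⟩ := x
        obtain ⟨x', hx'⟩ := x'
        obtain rfl : x = x' := h
        obtain rfl : w = w' := Subtype.ext (T.isTree.isAcyclic.eq_of_mem_branch w.2 w'.2 hx hx')
        rfl
    · intro x
      by_cases hx : x = T.root
      · exact ⟨none, hx.symm⟩
      · obtain ⟨w, hw, hxw⟩ := T.isTree.connected.exists_mem_branch hx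
        exact ⟨some ⟨⟨w, hw⟩, x, hxw⟩, rfl⟩
  have hroot (w : T.graph.neighborSet T.root) (x : (T.child w).V) :
      T.graph.Adj T.root x.1 ↔ x = (T.child w).root := by
    refine ⟨fun h => Subtype.ext ?_, fun h => h ▸ w.2⟩
    exact T.isTree.isAcyclic.eq_of_mem_branch h w.2 (mem_branch_self h.ne') x.2
  refine ⟨⟨Equiv.ofBijective f hbij, ?_⟩, rfl⟩
  rintro (_ | ⟨w, x⟩) (_ | ⟨w', x'⟩)
  · exact iff_of_false (SimpleGraph.irrefl _) (SimpleGraph.irrefl _)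
  · exact (hroot w' x').trans join_adj_root.symm
  · exact (SimpleGraph.adj_comm _ _ _).trans ((hroot w x).trans join_adj_root_symm.symm)
  · constructor
    · intro (h : T.graph.Adj x.1 x'.1)
      obtain rfl : w = w' := Subtype.ext (T.isTree.isAcyclic.eq_of_mem_branch w.2 w'.2
        (mem_branch_of_adj x.2 h (ne_of_mem_branch x'.2)) x'.2)
      exact .inner h
    · intro h
      cases h with
      | inner h => exact h

/-- The multiset of isomorphism classes of branches at the root. -/
noncomputable def branches (T : RootedSimpleTree) : Multiset (Quotient instSetoid) :=
  ofFamily fun w => ⟦T.child w⟧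

lemma branches_join {ι : Type} [Finite ι] (T : ι → RootedSimpleTree) :
    (join T).branches = ofFamily fun i => (⟦T i⟧ : Quotient instSetoid) := by
  symm
  let f : ι → (join T).graph.neighborSet (join T).root :=
    fun i => ⟨some ⟨i, (T i).root⟩, glue_adj_none.2 rfl⟩
  have hf : Function.Bijective f := by
    constructor
    · intro i j h
      exact congrArg Sigma.fst (Option.some.inj (congrArg Subtype.val h))
    · rintro ⟨_ | ⟨i, x⟩, h⟩
      · exact absurd h (SimpleGraph.irrefl (join T).graph)
      · obtain rfl := glue_adj_none.1 h
        exact ⟨i, rfl⟩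
  refine ofFamily_eq_iff.2 ⟨.ofBijective f hf, fun i => Quotient.sound ?_⟩
  have hb := branch_glue (r := fun i => (T i).root) (fun i => (T i).isTree.connected) i
  let g := glueEmbedding (fun i => (T i).graph) (fun i => (T i).root) i
  let e : (T i).V ≃ (glue (fun i => (T i).graph) fun i => (T i).root).branch none
      (some ⟨i, (T i).root⟩) := (Equiv.ofInjective g g.injective).trans (Equiv.setCongr hb.symm)
  exact ⟨⟨e, g.map_adj_iff⟩, rfl⟩

lemma branches_congr {T S : RootedSimpleTree} (h : T ≈ S) : T.branches = S.branches := by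
  obtain ⟨V, G, r, hG⟩ := T
  obtain ⟨V', G', r', hG'⟩ := S
  obtain ⟨φ : G ≃g G', rfl : φ r = r'⟩ := h
  exact ofFamily_eq_iff.2 ⟨φ.mapNeighborSet r, fun w =>
    Quotient.sound ⟨φ.induce (φ.bijOn_branch r w), rfl⟩⟩

/-- Isomorphism classes of rooted trees. -/
abbrev Iso : Type 1 := Quotient instSetoid

namespace Iso

/-- The number of vertices. -/
noncomputable def size : Iso → ℕ :=
  Quotient.lift (fun T => Nat.card T.V) fun _ _ ⟨φ, _⟩ => Nat.card_congr φ.toEquiv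

/-- The isomorphism classes of the branches at the root. -/
noncomputable def branches : Iso → Multiset Iso :=
  Quotient.lift RootedSimpleTree.branches fun _ _ => branches_congr

lemma branches_bijective : Function.Bijective branches := by
  constructor
  · intro q q'
    induction q, q' using Quotient.inductionOn₂ with
    | h T S =>
      intro h
      obtain ⟨e, he⟩ := ofFamily_eq_iff.1 h
      exact Quotient.sound (Setoid.trans (Setoid.symm T.join_child)
        (Setoid.trans (join_congr e fun i => Quotient.exact (he i)) S.join_child))
  · intro m
    obtain ⟨n, f, rfl⟩ := exists_eq_ofFamily m
    refine ⟨⟦join fun i => (f i).out⟧, (branches_join _).trans ?_⟩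
    simp

/-- A rooted tree is determined by its branches, which are arbitrary. -/
noncomputable def branchesEquiv : Iso ≃ Multiset Iso := .ofBijective _ branches_bijective

lemma size_eq (q : Iso) : q.size = (q.branches.map size).sum + 1 := by
  induction q using Quotient.inductionOn with
  | h T =>
    have := Fintype.ofFinite (T.graph.neighborSet T.root)
    rw [← Quotient.sound T.join_child]
    have hb : branches ⟦join T.child⟧ = ofFamily fun i => ⟦T.child i⟧ := branches_join _
    rw [hb, map_ofFamily, sum_ofFamily]
    change Nat.card (Option (Σ i, (T.child i).V)) = _
    rw [Finite.card_option, Nat.card_sigma]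
    rfl

lemma size_pos (q : Iso) : 0 < q.size := by
  rw [size_eq]
  exact Nat.succ_pos _

/-- The numbers of rooted trees with `k, k - 1, …, 1` vertices. -/
def counts : ℕ → List ℕ
  | 0 => []
  | k + 1 => weightCount (counts k) k :: counts k

/-- Rooted trees with `k + 1` vertices correspond to multisets of rooted trees with `k` vertices
in total. -/
noncomputable def sizeSuccEquiv (k : ℕ) : {q : Iso // q.size = k + 1} ≃ BoundedWeight size k k :=
  branchesEquiv.subtypeEquiv fun q => by
    rw [size_eq, Nat.add_right_cancel_iff]
    refine ⟨fun h => ⟨fun a ha => ?_, h⟩, And.right⟩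
    exact (Multiset.le_sum_of_mem (mem_map_of_mem size ha)).trans h.le

lemma finite_size_and_fiberCards (k : ℕ) :
    (∀ j ≤ k, Finite {q : Iso // q.size = j}) ∧ fiberCards size k = counts k := by
  induction k with
  | zero =>
    refine ⟨fun j hj => ?_, rfl⟩
    obtain rfl := Nat.le_zero.1 hj
    have : IsEmpty {q : Iso // q.size = 0} := ⟨fun q => q.1.size_pos.ne' q.2⟩
    infer_instance
  | succ k ih =>
    obtain ⟨hfin, hcard⟩ := finite_and_card_boundedWeight size_pos k k ih.1
    refine ⟨fun j hj => ?_, ?_⟩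
    · obtain hj | rfl := Nat.le_succ_iff.1 hj
      · exact ih.1 j hj
      · exact .of_equiv _ (sizeSuccEquiv k).symm
    · rw [fiberCards, counts, Nat.card_congr (sizeSuccEquiv k), hcard, ih.2]

lemma card_centered (k n : ℕ) :
    Nat.card {q : Iso // q.size = n + 1 ∧ ∀ b ∈ q.branches, b.size ≤ k} =
      weightCount (counts k) n := by
  obtain ⟨hfin, hcounts⟩ := finite_size_and_fiberCards k
  rw [← hcounts, ← (finite_and_card_boundedWeight size_pos k n hfin).2]
  refine Nat.card_congr (branchesEquiv.subtypeEquiv fun q => ?_)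
  rw [size_eq, Nat.add_right_cancel_iff, and_comm]
  rfl

end Iso

lemma forall_branches_size_le {T : RootedSimpleTree} {k : ℕ} :
    (∀ b ∈ Iso.branches ⟦T⟧, b.size ≤ k) ↔
      ∀ w, T.graph.Adj T.root w → (T.graph.branch T.root w).ncard ≤ k := by
  constructor
  · exact fun h w hw => h _ (mem_ofFamily.2 ⟨⟨w, hw⟩, rfl⟩)
  · intro h b hb
    obtain ⟨w, rfl⟩ := mem_ofFamily.1 hb
    exact h w w.2

end RootedSimpleTree

open RootedSimpleTree

/-- Rooted trees that are both rooted at a centroid are isomorphic if the trees are. -/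
lemma RootedSimpleTree.equiv_of_iso {T S : RootedSimpleTree} {k : ℕ} (φ : T.graph ≃g S.graph)
    (hsize : Iso.size ⟦S⟧ = 2 * k + 1) (hT : ∀ b ∈ Iso.branches ⟦T⟧, b.size ≤ k)
    (hS : ∀ b ∈ Iso.branches ⟦S⟧, b.size ≤ k) : T ≈ S := by
  let T' : RootedSimpleTree := ⟨S.V, S.graph, φ T.root, S.isTree⟩
  have hTT' : T ≈ T' := ⟨φ, rfl⟩
  rw [Quotient.sound hTT'] at hT
  have hcard : Nat.card S.V = 2 * k + 1 := hsize
  refine ⟨φ, S.isTree.connected.eq_of_forall_two_mul_ncard_branch_lt (fun w hw => ?_)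
    fun w hw => ?_⟩
  · have : (S.graph.branch (φ T.root) w).ncard ≤ k := forall_branches_size_le.1 hT w hw
    omega
  · have := forall_branches_size_le.1 hS w hw
    omega

/-- A tree with an odd number of vertices has a unique centroid, so it may be rooted there. -/
lemma card_quotient_treeIsoSetoid (k : ℕ) :
    Nat.card (Quotient (treeIsoSetoid (2 * k + 1))) =
      Multiset.weightCount (Iso.counts k) (2 * k) := by
  rw [← Iso.card_centered]
  let R (t : Quotient (treeIsoSetoid (2 * k + 1))) (q : Iso) : Prop :=
    ∃ G T, t = ⟦G⟧ ∧ q = ⟦T⟧ ∧ Nonempty (G.1 ≃g T.graph)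
  have hR (t) : ∃ q : {q : Iso // q.size = 2 * k + 1 ∧ ∀ b ∈ q.branches, b.size ≤ k}, R t q := by
    induction t using Quotient.inductionOn with
    | h G =>
      have hG : G.1.IsTree := ⟨G.2.1, G.2.2⟩
      obtain ⟨r, hr⟩ := hG.exists_forall_two_mul_ncard_branch_le
      let T : RootedSimpleTree := ⟨_, G.1, r, hG⟩
      have hcard : Nat.card (Fin (2 * k + 1)) = 2 * k + 1 := Nat.card_fin _
      refine ⟨⟨⟦T⟧, hcard, forall_branches_size_le.2 fun w hw => ?_⟩, G, T, rfl, rfl, ⟨.refl⟩⟩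
      have := hr w hw
      change (G.1.branch r w).ncard ≤ k
      omega
  choose f hf using hR
  refine Nat.card_congr (.ofBijective f ⟨fun t t' h => ?_, fun ⟨q, hsize, hq⟩ => ?_⟩)
  · obtain ⟨G, T, rfl, hT, ⟨φ⟩⟩ := hf t
    obtain ⟨G', T', rfl, hT', ⟨ψ⟩⟩ := hf t'
    obtain ⟨θ, -⟩ := Quotient.exact (hT.symm.trans ((congrArg Subtype.val h).trans hT'))
    exact Quotient.sound ⟨(φ.trans θ).trans ψ.symm⟩
  · induction q using Quotient.inductionOn with
    | h S =>
      have e : S.V ≃ Fin (2 * k + 1) := Finite.equivFinOfCardEq hsize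
      let φ := SimpleGraph.Iso.map e S.graph
      have hH := φ.isTree_iff.1 S.isTree
      refine ⟨⟦⟨_, hH.connected, hH.isAcyclic⟩⟧, Subtype.ext ?_⟩
      obtain ⟨G, T, hG, hT, ⟨ψ⟩⟩ := hf ⟦⟨_, hH.connected, hH.isAcyclic⟩⟧
      obtain ⟨θ⟩ := Quotient.exact hG
      have hprop := (f ⟦⟨_, hH.connected, hH.isAcyclic⟩⟧).2
      rw [hT] at hprop ⊢
      exact Quotient.sound (equiv_of_iso ((φ.trans θ).trans ψ).symm hsize hprop.2 hq)

/-- The number of isomorphism classes of trees on 21 vertices is 2144505. -/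
theorem card_tree_iso_classes_21 :
    Nat.card (Quotient (treeIsoSetoid 21)) = 2144505 := by
  rw [card_quotient_treeIsoSetoid 10]
  decide +kernel
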